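/- arXiv:1607.00196 — 4 statements merged into one kernel-verified Lean document; each statement's English description precedes it below -/
import Mathlib

section
/- Assign to the generating variable Î(a_0; a_1,…,a_{n−1}; a_n) the weight n − 1 (the length of the middle word), and grade H by weighted total degree, H = ⊕_{d≥0} H_d. Then Δ is homogeneous of degree 0 for this grading: if p ∈ H is weighted-homogeneous of degree d, then Δ(p) lies in Σ_{p'+q'=d} H_{p'} ⊗ H_{q'} ⊆ H ⊗_ℚ H. -/
open scoped TensorProduct

/-- The generators `Î(a₀; a₁,…,a_{n−1}; a_n)` of Goncharov's algebra: sequences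
`(a₀,…,a_N)` of elements of `S` with `N ≥ 2`, encoded as pairs `⟨n, a⟩` with
`a : Fin (n+3) → S` (so that `N = n + 2`). -/
abbrev GonVars (S : Type*) := Σ n : ℕ, (Fin (n + 3) → S)

/-- Goncharov's algebra: the polynomial algebra over `ℚ` on the symbols
`Î(a₀; a₁,…,a_{n−1}; a_n)`. -/
abbrev GonAlg (S : Type*) := MvPolynomial (GonVars S) ℚ

/-- The symbol `Î(a₀; a₁,…,a_{n−1}; a_n)` attached to an arbitrary sequence
`(a₀,…,a_n)`: the corresponding polynomial generator if `n ≥ 2`, and `1` if the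
middle word is empty (the convention `Î(a;∅;b) = 1`). -/
noncomputable def Isym (S : Type*) (n : ℕ) (a : Fin (n + 1) → S) : GonAlg S :=
  if h : 2 ≤ n then MvPolynomial.X ⟨n - 2, fun j => a (Fin.cast (by omega) j)⟩ else 1

/-- The type of chains `0 = i₀ < i₁ < ⋯ < i_k = N` in `{0,…,N}`. -/
def Chains (N k : ℕ) : Type :=
  {i : Fin (k + 1) → Fin (N + 1) // StrictMono i ∧ i 0 = 0 ∧ i (Fin.last k) = Fin.last N}

instance (N k : ℕ) : Finite (Chains N k) := by
  unfold Chains; infer_instance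

/-- The value of Goncharov's coproduct on a generator:
`Δ(Î(a₀;…;a_N)) = Σ_k Σ_{0=i₀<⋯<i_k=N} Î(a_{i₀};a_{i₁},…;a_{i_k}) ⊗
Π_j Î(a_{i_{j−1}}; a_{i_{j−1}+1},…; a_{i_j})`. -/
noncomputable def GonDeltaGen (S : Type*) (v : GonVars S) : GonAlg S ⊗[ℚ] GonAlg S :=
  ∑ k ∈ Finset.Icc 1 (v.1 + 2),
    ∑ᶠ i : Chains (v.1 + 2) k,
      Isym S k (fun j => v.2 (i.1 j)) ⊗ₜ[ℚ]
        ∏ j : Fin k,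
          Isym S ((i.1 j.succ : ℕ) - (i.1 j.castSucc : ℕ))
            (fun t => v.2 ⟨(i.1 j.castSucc : ℕ) + (t : ℕ), by
              have h1 := (i.1 j.succ).isLt
              have h2 := (i.1 j.castSucc).isLt
              have h3 := t.isLt
              omega⟩)

/-- Goncharov's coproduct, as a `ℚ`-algebra homomorphism. -/
noncomputable def GonDelta (S : Type*) : GonAlg S →ₐ[ℚ] GonAlg S ⊗[ℚ] GonAlg S :=
  MvPolynomial.aeval (GonDeltaGen S)

/-- The counit, sending every generator to `0`. -/
noncomputable def GonEps (S : Type*) : GonAlg S →ₐ[ℚ] ℚ :=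
  MvPolynomial.aeval (fun _ => (0 : ℚ))


/-- The weight of the generator `Î(a₀;…;a_N)` is `N − 1`; here `N = v.1 + 2`. -/
def gonWeight (S : Type*) : GonVars S → ℕ := fun v => v.1 + 1

/-- The degree `d` part of the tensor square. -/
noncomputable def GonF (S : Type) (d : ℕ) : Submodule ℚ (GonAlg S ⊗[ℚ] GonAlg S) :=
  ⨆ (pq : ℕ × ℕ) (_ : pq.1 + pq.2 = d),
        LinearMap.range
          (TensorProduct.map
            (MvPolynomial.weightedHomogeneousSubmodule ℚ (gonWeight S) pq.1).subtype
            (MvPolynomial.weightedHomogeneousSubmodule ℚ (gonWeight S) pq.2).subtype)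

theorem GonF_tmul (S : Type) {d p q : ℕ} (h : p + q = d) {a b : GonAlg S}
    (ha : MvPolynomial.IsWeightedHomogeneous (gonWeight S) a p)
    (hb : MvPolynomial.IsWeightedHomogeneous (gonWeight S) b q) :
    a ⊗ₜ[ℚ] b ∈ GonF S d := by
  refine Submodule.mem_iSup_of_mem (p, q) (Submodule.mem_iSup_of_mem h ?_)
  exact ⟨(⟨a, ha⟩ : MvPolynomial.weightedHomogeneousSubmodule ℚ (gonWeight S) p) ⊗ₜ
    (⟨b, hb⟩ : MvPolynomial.weightedHomogeneousSubmodule ℚ (gonWeight S) q), by simp⟩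

theorem GonF_le (S : Type) {d : ℕ} (T : Submodule ℚ (GonAlg S ⊗[ℚ] GonAlg S))
    (H : ∀ (p q : ℕ) (a b : GonAlg S), p + q = d →
      MvPolynomial.IsWeightedHomogeneous (gonWeight S) a p →
      MvPolynomial.IsWeightedHomogeneous (gonWeight S) b q → a ⊗ₜ[ℚ] b ∈ T) :
    GonF S d ≤ T := by
  refine iSup_le fun pq => iSup_le fun h => ?_
  rintro _ ⟨x, rfl⟩
  induction x using TensorProduct.induction_on with
  | zero => simp
  | tmul a b => simpa using H pq.1 pq.2 a b h a.2 b.2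
  | add x y hx hy => rw [map_add]; exact T.add_mem hx hy

theorem GonF_one (S : Type) : (1 : GonAlg S ⊗[ℚ] GonAlg S) ∈ GonF S 0 :=
  GonF_tmul S (p := 0) (q := 0) rfl (MvPolynomial.isWeightedHomogeneous_one _ _)
    (MvPolynomial.isWeightedHomogeneous_one _ _)

theorem GonF_mul (S : Type) {d e : ℕ} {x y : GonAlg S ⊗[ℚ] GonAlg S}
    (hx : x ∈ GonF S d) (hy : y ∈ GonF S e) : x * y ∈ GonF S (d + e) := by
  have key : GonF S d ≤ (GonF S (d + e)).comap (LinearMap.mulRight ℚ y) := by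
    refine GonF_le S _ fun p q a b h ha hb => ?_
    have key2 : GonF S e ≤ (GonF S (d + e)).comap (LinearMap.mulLeft ℚ (a ⊗ₜ[ℚ] b)) := by
      refine GonF_le S _ fun p' q' a' b' h' ha' hb' => ?_
      simp only [Submodule.mem_comap, LinearMap.mulLeft_apply,
        Algebra.TensorProduct.tmul_mul_tmul]
      exact GonF_tmul S (by omega) (ha.mul ha') (hb.mul hb')
    exact key2 hy
  exact key hx

theorem GonF_pow (S : Type) {d : ℕ} {x : GonAlg S ⊗[ℚ] GonAlg S}
    (hx : x ∈ GonF S d) (n : ℕ) : x ^ n ∈ GonF S (n * d) := by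
  induction n with
  | zero => simpa using GonF_one S
  | succ n ih => rw [pow_succ, Nat.succ_mul]; exact GonF_mul S ih hx

theorem GonF_prod (S : Type) {ι : Type} (s : Finset ι) (f : ι → GonAlg S ⊗[ℚ] GonAlg S)
    (w : ι → ℕ) (h : ∀ i ∈ s, f i ∈ GonF S (w i)) :
    ∏ i ∈ s, f i ∈ GonF S (∑ i ∈ s, w i) := by
  classical
  induction s using Finset.induction_on with
  | empty => simpa using GonF_one S
  | insert a s ha ih =>
    rw [Finset.prod_insert ha, Finset.sum_insert ha]
    exact GonF_mul S (h a (by simp)) (ih fun i hi => h i (by simp [hi]))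

theorem Isym_hom (S : Type) (n : ℕ) (a : Fin (n + 1) → S) :
    MvPolynomial.IsWeightedHomogeneous (gonWeight S) (Isym S n a) (n - 1) := by
  unfold Isym
  split_ifs with h
  · have := MvPolynomial.isWeightedHomogeneous_X ℚ (gonWeight S)
      (⟨n - 2, fun j => a (Fin.cast (by omega) j)⟩ : GonVars S)
    have e : n - 1 = n - 2 + 1 := by omega
    rw [e]
    exact this
  · have e : n - 1 = 0 := by omega
    rw [e]
    exact MvPolynomial.isWeightedHomogeneous_one _ _

theorem chain_sum : ∀ (k : ℕ) (f : Fin (k + 1) → ℕ), StrictMono f →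
    ∑ j : Fin k, (f j.succ - f j.castSucc - 1) + k + f 0 = f (Fin.last k) := by
  intro k
  induction k with
  | zero => intro f _; simp
  | succ k ih =>
    intro f hf
    have h1 := ih (fun j => f j.castSucc) (fun a b h => hf (by simpa using h))
    rw [Fin.sum_univ_castSucc]
    have h2 : f (Fin.last k).castSucc < f (Fin.last k).succ := hf (Fin.castSucc_lt_succ)
    simp only [Fin.succ_castSucc, Fin.castSucc_zero, Fin.succ_last, Nat.succ_eq_add_one] at h1 h2 ⊢
    omega

theorem GonDeltaGen_mem (S : Type) (v : GonVars S) : GonDeltaGen S v ∈ GonF S (gonWeight S v) := by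
  unfold GonDeltaGen
  refine Submodule.sum_mem _ fun k hk => ?_
  rw [Finset.mem_Icc] at hk
  refine finsum_induction (· ∈ GonF S (gonWeight S v)) (Submodule.zero_mem _)
    (fun _ _ => Submodule.add_mem _) fun i => ?_
  refine GonF_tmul S ?_ (Isym_hom S _ _)
    (MvPolynomial.IsWeightedHomogeneous.prod _ _ _ fun j _ => Isym_hom S _ _)
  have h := chain_sum k (fun j => (i.1 j : ℕ)) (fun a b h => i.2.1 h)
  simp only [i.2.2.1, i.2.2.2, Fin.val_zero, Fin.val_last] at h
  unfold gonWeight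
  omega

theorem goncharov_coproduct_graded (S : Type) (d : ℕ) (p : GonAlg S)
    (hp : p ∈ MvPolynomial.weightedHomogeneousSubmodule ℚ (gonWeight S) d) :
    GonDelta S p ∈
      ⨆ (pq : ℕ × ℕ) (_ : pq.1 + pq.2 = d),
        LinearMap.range
          (TensorProduct.map
            (MvPolynomial.weightedHomogeneousSubmodule ℚ (gonWeight S) pq.1).subtype
            (MvPolynomial.weightedHomogeneousSubmodule ℚ (gonWeight S) pq.2).subtype) := by
  change GonDelta S p ∈ GonF S d
  rw [MvPolynomial.mem_weightedHomogeneousSubmodule] at hp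
  rw [p.as_sum, map_sum]
  refine Submodule.sum_mem _ fun m hm => ?_
  have hw := hp (MvPolynomial.mem_support_iff.mp hm)
  unfold GonDelta
  rw [MvPolynomial.aeval_monomial, ← Algebra.smul_def]
  refine Submodule.smul_mem _ _ ?_
  rw [← hw, Finsupp.weight_apply]
  exact GonF_prod S _ _ _ fun i _ => GonF_pow S (GonDeltaGen_mem S i) _
end

section
/- There exists a ℚ-linear map (antipode) Antip : H → H such that mul ∘ (Antip ⊗ id) ∘ Δ = η ∘ ε = mul ∘ (id ⊗ Antip) ∘ Δ, where mul : H ⊗_ℚ H → H is the multiplication and η : ℚ → H is the unit map. Hence H with Δ and ε is a Hopf algebra over ℚ (Goncharov's Hopf algebra H_G). -/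
open scoped TensorProduct

section GonAux
variable {S R : Type} [CommRing R]

/-- Path product. -/
def gprod : (List S → R) → (List S → R) → List S → R
  | _, _, [] => 0
  | F, G, a :: l => F [a] * G (a :: l) + gprod (fun x => F (a :: x)) G l

/-- Auxiliary recursion for substitution. -/
def gU (g : List S → R) : (List S → R) → (List S → R) → List S → R
  | _, _, [] => 0
  | γ, φ, b :: v =>
      γ [b] * ((if v = [] then φ [b] else 0) + gU g (fun x => g (b :: x)) (fun x => φ (b :: x)) v)
        + gU g (fun x => γ (b :: x)) φ v

/-- Substitution operator. -/
def gT (g φ : List S → R) : List S → R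
  | [] => 0
  | b :: v => (if v = [] then φ [b] else 0) + gU g (fun x => g (b :: x)) (fun x => φ (b :: x)) v

theorem gU_eq (g : List S → R) (v : List S) : ∀ γ φ : List S → R,
    gU g γ φ v = gprod γ (gT g φ) v := by
  induction v with
  | nil => intro γ φ; simp [gU, gprod]
  | cons b v ih =>
    intro γ φ
    simp only [gU, gprod, gT]
    rw [ih (fun x => γ (b :: x)) φ]

theorem gT_nil (g φ : List S → R) : gT g φ [] = 0 := rfl

theorem gT_cons (g φ : List S → R) (b : S) (v : List S) :
    gT g φ (b :: v) = (if v = [] then φ [b] else 0)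
      + gprod (fun x => g (b :: x)) (gT g (fun x => φ (b :: x))) v := by
  rw [gT, gU_eq]

theorem gT_single (g φ : List S → R) (b : S) : gT g φ [b] = φ [b] := by
  simp [gT_cons, gprod]

theorem gprod_congr (l : List S) : ∀ F F' G G' : List S → R,
    (∀ x, x ≠ [] → x.length ≤ l.length → F x = F' x) → (∀ x, x.length ≤ l.length → G x = G' x) →
    gprod F G l = gprod F' G' l := by
  induction l with
  | nil => intros; simp [gprod]
  | cons a l ih =>
    intro F F' G G' h1 h2
    simp only [gprod]
    rw [h1 [a] (by simp) (by simp), h2 (a :: l) le_rfl]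
    rw [ih _ (fun x => F' (a :: x)) G G']
    · intro x hx hl; exact h1 _ (by simp) (by simpa using hl)
    · intro x hl; exact h2 _ (by simp; omega)

theorem gprod_add_left (l : List S) : ∀ F F' G : List S → R,
    gprod (fun x => F x + F' x) G l = gprod F G l + gprod F' G l := by
  induction l with
  | nil => intros; simp [gprod]
  | cons a l ih => intro F F' G; simp only [gprod]; rw [ih]; ring

theorem gprod_smul_left (c : R) (l : List S) : ∀ F G : List S → R,
    gprod (fun x => c * F x) G l = c * gprod F G l := by
  induction l with
  | nil => intros; simp [gprod]
  | cons a l ih => intro F G; simp only [gprod]; rw [ih]; ring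

theorem gprod_add_right (l : List S) : ∀ F G G' : List S → R,
    gprod F (fun x => G x + G' x) l = gprod F G l + gprod F G' l := by
  induction l with
  | nil => intros; simp [gprod]
  | cons a l ih => intro F F' G; simp only [gprod]; rw [ih]; ring

theorem gprod_smul_right (c : R) (l : List S) : ∀ F G : List S → R,
    gprod F (fun x => c * G x) l = c * gprod F G l := by
  induction l with
  | nil => intros; simp [gprod]
  | cons a l ih => intro F G; simp only [gprod]; rw [ih]; ring

theorem gprod_assoc (l : List S) : ∀ F G K : List S → R,
    gprod (gprod F G) K l = gprod F (gprod G K) l := by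
  induction l with
  | nil => intros; simp [gprod]
  | cons a l ih =>
    intro F G K
    simp only [gprod]
    rw [gprod_add_left, gprod_smul_left, ih]; ring

theorem gT_congr (n : ℕ) : ∀ (l : List S), l.length ≤ n → ∀ g g' φ φ' : List S → R,
    (∀ x, x.length ≤ n → g x = g' x) → (∀ x, x ≠ [] → x.length ≤ n → φ x = φ' x) →
    gT g φ l = gT g' φ' l := by
  induction n with
  | zero =>
    intro l hl; have : l = [] := by simpa using hl
    subst this; intros; rfl
  | succ n ih =>
    intro l hl g g' φ φ' h1 h2
    cases l with
    | nil => rfl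
    | cons a w =>
      simp at hl
      rw [gT_cons, gT_cons, h2 [a] (by simp) (by simp)]
      congr 1
      apply gprod_congr
      · intro x _ hx; exact h1 _ (by simp; omega)
      · intro x hx
        apply ih _ (by omega)
        · intro y hy; exact h1 _ (by omega)
        · intro y _ hy; exact h2 _ (by simp) (by simp; omega)

theorem gT_congr_right (g φ φ' : List S → R) (l : List S) (h : ∀ x, x ≠ [] → φ x = φ' x) :
    gT g φ l = gT g φ' l :=
  gT_congr l.length l le_rfl _ _ _ _ (fun _ _ => rfl) (fun x hx _ => h x hx)

theorem gT_lin (g : List S → R) (c : R) (n : ℕ) : ∀ (l : List S), l.length ≤ n →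
    ∀ φ ψ : List S → R,
    gT g (fun x => c * φ x + ψ x) l = c * gT g φ l + gT g ψ l := by
  induction n with
  | zero =>
    intro l hl; have : l = [] := by simpa using hl
    subst this; intros; simp [gT_nil]
  | succ n ih =>
    intro l hl φ ψ
    cases l with
    | nil => simp [gT_nil]
    | cons a w =>
      simp at hl
      rw [gT_cons, gT_cons, gT_cons]
      rw [gprod_congr w _ (fun x => g (a :: x)) _ (fun x => c * gT g (fun x => φ (a :: x)) x +
        gT g (fun x => ψ (a :: x)) x) (fun _ _ _ => rfl) (fun x hx => ih x (by omega) _ _)]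
      rw [gprod_add_right, gprod_smul_right]
      split_ifs <;> ring

theorem gT_gprod (h : List S → R) (n : ℕ) : ∀ (l : List S), l.length ≤ n →
    ∀ F G : List S → R, gT h (gprod F G) l = gprod (gT h F) (gT h G) l := by
  induction n with
  | zero =>
    intro l hl; have : l = [] := by simpa using hl
    subst this; intros; rfl
  | succ n ih =>
    intro l hl F G
    cases l with
    | nil => rfl
    | cons a w =>
      simp at hl
      rw [gT_cons]
      have e1 : gprod (fun x => h (a :: x)) (gT h (fun x => gprod F G (a :: x))) w
          = F [a] * gprod (fun x => h (a :: x)) (gT h (fun x => G (a :: x))) w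
            + gprod (fun x => h (a :: x)) (gprod (gT h (fun x => F (a :: x))) (gT h G)) w := by
        rw [← gprod_smul_right, ← gprod_add_right]
        apply gprod_congr _ _ _ _ _ (fun _ _ _ => rfl)
        intro x hx
        rw [← ih x (by omega), ← gT_lin h _ _ x le_rfl]
        rfl
      have e2 : gprod (fun x => gT h F (a :: x)) (gT h G) w
          = gprod (gprod (fun x => h (a :: x)) (gT h (fun x => F (a :: x)))) (gT h G) w := by
        apply gprod_congr _ _ _ _ _ _ (fun _ _ => rfl)
        intro x hx _
        rw [gT_cons]; simp [hx]
      rw [e1]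
      simp only [gprod]
      rw [e2, gprod_assoc, gT_single, gT_cons h G]
      split_ifs <;> ring

theorem gT_comp (h g : List S → R) (n : ℕ) : ∀ (l : List S), l.length ≤ n →
    ∀ φ : List S → R, gT h (gT g φ) l = gT (gT h g) φ l := by
  induction n with
  | zero =>
    intro l hl; have : l = [] := by simpa using hl
    subst this; intros; rfl
  | succ n ih =>
    intro l hl φ
    cases l with
    | nil => rfl
    | cons a w =>
      simp at hl
      rw [gT_cons h, gT_cons (gT h g), gT_single]
      congr 1
      have e1 : gprod (fun x => h (a :: x)) (gT h (fun x => gT g φ (a :: x))) w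
          = gprod (fun x => h (a :: x)) (gprod (gT h (fun x => g (a :: x)))
              (gT h (gT g (fun x => φ (a :: x))))) w := by
        apply gprod_congr _ _ _ _ _ (fun _ _ _ => rfl)
        intro x hx
        rw [← gT_gprod h _ x le_rfl]
        apply gT_congr_right
        intro y hy
        rw [gT_cons]; simp [hy]
      rw [e1, ← gprod_assoc]
      apply gprod_congr
      · intro x hx _
        rw [gT_cons]; simp [hx]
      · intro x hx
        exact ih x (by omega) _

/-- The unit. -/
def ge (S R : Type) [CommRing R] (l : List S) : R := if l.length = 2 then 1 else 0

theorem gprod_zero_left (l : List S) : ∀ (F G : List S → R), (∀ x, x ≠ [] → F x = 0) →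
    gprod F G l = 0 := by
  induction l with
  | nil => intros; rfl
  | cons a l ih =>
    intro F G h
    simp only [gprod]
    rw [ih _ _ (fun x _ => h (a :: x) (by simp)), h _ (by simp)]; ring

theorem gprod_zero_right (l : List S) : ∀ (F G : List S → R), (∀ x, G x = 0) →
    gprod F G l = 0 := by
  induction l with
  | nil => intros; rfl
  | cons a l ih =>
    intro F G h
    simp only [gprod]
    rw [ih _ _ h, h]; ring

theorem gprod_unit_right (l : List S) (hl : l ≠ []) : ∀ (F G : List S → R),
    (∀ x, x ≠ [] → G x = if x.length = 1 then 1 else 0) →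
    gprod F G l = F l := by
  induction l with
  | nil => exact absurd rfl hl
  | cons a l ih =>
    intro F G h
    simp only [gprod]
    rw [h _ (by simp)]
    cases l with
    | nil => simp [gprod]
    | cons b l => rw [ih (by simp) _ _ h]; simp

theorem gT_zero (g : List S → R) (φ : List S → R) (hφ : ∀ x, x ≠ [] → φ x = 0) (l : List S) :
    gT g φ l = 0 := by
  have h1 := gT_congr_right g φ (fun x => (-1) * φ x + φ x) l (fun x hx => by simp [hφ x hx])
  rw [gT_lin g (-1) _ l le_rfl] at h1
  rw [h1]; ring

theorem gT_unit_left (n : ℕ) : ∀ (l : List S), l.length ≤ n → l ≠ [] → ∀ φ : List S → R,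
    gT (ge S R) φ l = φ l := by
  induction n with
  | zero => intro l hl h0; simp at hl; exact absurd hl h0
  | succ n ih =>
    intro l hl h0 φ
    cases l with
    | nil => exact absurd rfl h0
    | cons a w =>
      rw [gT_cons]
      cases w with
      | nil => simp [gprod]
      | cons b v =>
        simp at hl
        simp only [gprod]
        rw [gprod_zero_left, ih (b :: v) (by simp; omega) (by simp)]
        · simp [ge]
        · intro x hx; simp [ge, hx]

theorem gT_unit_right (g : List S → R) (a : S) (w : List S) (hw : w ≠ []) :
    gT g (ge S R) (a :: w) = g (a :: w) := by
  rw [gT_cons, gprod_unit_right w hw]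
  · simp [hw]
  · intro x hx
    cases x with
    | nil => exact absurd rfl hx
    | cons b v =>
      rw [gT_cons, gprod_zero_right]
      · simp [ge]
      · intro y; apply gT_zero
        intro z hz; simp [ge, hz]

theorem gprod_local (w : List S) : ∀ F F' G G' : List S → R,
    (∀ x, x.length < w.length → F x = F' x) → (∀ x, x.length ≤ w.length → G x = G' x) →
    (∀ c, G [c] = 1) →
    gprod F G w - F w = gprod F' G' w - F' w ∨ w = [] := by
  induction w with
  | nil => intros; right; rfl
  | cons b v ih =>
    intro F F' G G' h1 h2 h3
    left
    simp only [gprod]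
    by_cases hv : v = []
    · subst hv
      simp [gprod, ← h2 [b] (by simp), h3]
    · have := (ih (fun x => F (b :: x)) (fun x => F' (b :: x)) G G'
        (fun x hx => h1 _ (by simpa using hx)) (fun x hx => h2 _ (by simp; omega)) h3).resolve_right hv
      rw [h1 [b] (by simpa [List.length_pos_iff] using hv), h2 (b :: v) le_rfl]
      linear_combination this

/-- Normalized characters. -/
def gNorm (g : List S → R) : Prop := g [] = 0 ∧ (∀ a, g [a] = 0) ∧ ∀ a b, g [a, b] = 1

theorem gQ_local (g : List S → R) (hg : gNorm g) (B B' : List S → R) (l : List S)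
    (hl : 2 ≤ l.length) (h : ∀ x, x.length < l.length → B x = B' x) :
    gT B g l - B l = gT B' g l - B' l := by
  cases l with
  | nil => simp at hl
  | cons a w =>
    have hw : w ≠ [] := by rintro rfl; simp at hl
    rw [gT_cons, gT_cons]
    simp only [hw, if_false, zero_add]
    refine (gprod_local w (fun x => B (a :: x)) (fun x => B' (a :: x)) _ _ ?_ ?_ ?_).resolve_right hw
    · intro x hx; exact h _ (by simpa using hx)
    · intro x hx
      apply gT_congr w.length x hx
      · intro y hy; exact h _ (by simp; omega)
      · intros; rfl
    · intro c; rw [gT_single]; exact hg.2.2 a c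

/-- Approximations to the inverse. -/
def gBn (g : List S → R) : ℕ → List S → R
  | 0, _ => 0
  | n + 1, l => if l.length < 2 then 0 else ge S R l - (gT (gBn g n) g l - gBn g n l)

theorem gBn_stable (g : List S → R) (hg : gNorm g) (n : ℕ) : ∀ l : List S, l.length ≤ n →
    gBn g (n + 1) l = gBn g n l := by
  induction n with
  | zero => intro l hl; simp at hl; subst hl; simp [gBn]
  | succ n ih =>
    intro l hl
    by_cases h2 : l.length < 2
    · simp [gBn, h2]
    · conv_rhs => rw [gBn, if_neg h2]
      rw [gBn, if_neg h2]
      rw [gQ_local g hg _ (gBn g n) l (by omega) (fun x hx => ih x (by omega))]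

theorem gBn_ge (g : List S → R) (hg : gNorm g) (l : List S) (n : ℕ) (h : l.length ≤ n) :
    gBn g n l = gBn g l.length l := by
  induction n, h using Nat.le_induction with
  | base => rfl
  | succ n hn ih => rw [gBn_stable g hg n l hn, ih]

theorem exists_right_inv (g : List S → R) (hg : gNorm g) :
    ∃ B : List S → R, gNorm B ∧ gT B g = ge S R := by
  let B : List S → R := fun l => gBn g l.length l
  have key : ∀ l : List S, 2 ≤ l.length → gT B g l = ge S R l := by
    intro l hl
    have h1 := gQ_local g hg B (gBn g l.length) l hl
      (fun x hx => (gBn_ge g hg x l.length hx.le).symm)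
    have h2 := gBn_stable g hg l.length l le_rfl
    rw [gBn, if_neg (by omega)] at h2
    have h3 : B l = gBn g l.length l := rfl
    linear_combination h1 - h2
  have n1 : B [] = 0 := rfl
  have n2 : ∀ a, B [a] = 0 := fun a => by simp [B, gBn]
  refine ⟨B, ⟨n1, n2, fun a b => ?_⟩, ?_⟩
  · have := key [a, b] (by simp)
    rw [gT_cons] at this
    simpa [gprod, gT_single, hg.2.2, ge] using this
  · funext l
    match l with
    | [] => simp [gT_nil, ge]
    | [a] => simp [gT_single, ge, hg.2.1]
    | a :: b :: t => exact key _ (by simp)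

theorem exists_inv (g : List S → R) (hg : gNorm g) :
    ∃ B : List S → R, gNorm B ∧ gT B g = ge S R ∧ gT g B = ge S R := by
  obtain ⟨B, hB, h1⟩ := exists_right_inv g hg
  obtain ⟨C, hC, h2⟩ := exists_right_inv B hB
  have : g = C := by
    funext l
    match l with
    | [] => rw [hg.1, hC.1]
    | [a] => rw [hg.2.1, hC.2.1]
    | a :: b :: t =>
      have h3 := gT_comp C B _ (a :: b :: t) le_rfl g
      rw [h1, h2, gT_unit_right _ _ _ (by simp), gT_unit_left _ _ le_rfl (by simp)] at h3
      exact h3.symm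
  exact ⟨B, hB, h1, this ▸ h2⟩

/-- A segment of a sequence. -/
def gseg (a : ℕ → S) (s n : ℕ) : List S := (List.range' s n).map a

theorem gseg_succ (a : ℕ → S) (s n : ℕ) : gseg a s (n + 1) = a s :: gseg a (s + 1) n := by
  simp [gseg, List.range'_succ]

theorem gprod_seg (a : ℕ → S) (n : ℕ) : ∀ (s : ℕ) (F G : List S → R),
    gprod F G (gseg a s n) = ∑ m ∈ Finset.range n, F (gseg a s (m + 1)) * G (gseg a (s + m) (n - m)) := by
  induction n with
  | zero => intros; simp [gseg, gprod]
  | succ n ih =>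
    intro s F G
    rw [gseg_succ, gprod, ih, Finset.sum_range_succ']
    rw [add_comm]
    congr 1
    · apply Finset.sum_congr rfl
      intro m _
      rw [gseg_succ a s (m + 1)]
      congr 3 <;> omega

open Classical in
/-- Chain sums. -/
noncomputable def gD (a : ℕ → S) (N : ℕ) (g φ : List S → R) (s k : ℕ) : R :=
  ∑ i : Fin (k + 1) → Fin (N + 1),
    if StrictMono i ∧ (i 0 : ℕ) = s ∧ i (Fin.last k) = Fin.last N then
      φ (List.ofFn fun j => a (i j)) *
        ∏ j : Fin k, g (gseg a (i j.castSucc) ((i j.succ : ℕ) - i j.castSucc + 1))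
    else 0

theorem strictMono_cons_iff {α : Type} [Preorder α] {k : ℕ} (x : α) (t : Fin (k + 1) → α) :
    StrictMono (Fin.cons x t : Fin (k + 2) → α) ↔ x < t 0 ∧ StrictMono t := by
  rw [Fin.strictMono_iff_lt_succ, Fin.forall_fin_succ, Fin.strictMono_iff_lt_succ]
  simp

theorem gD_zero (a : ℕ → S) (N : ℕ) (g φ : List S → R) (s : ℕ) (hs : s ≤ N) :
    gD a N g φ s 0 = if s = N then φ [a s] else 0 := by
  classical
  unfold gD
  rw [Fintype.sum_eq_single (fun _ => Fin.last N)]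
  · by_cases h : s = N
    · subst h; have : StrictMono (fun _ : Fin (0 + 1) => Fin.last s) := by
        intro x y hxy; omega
      simp [this]
    · simp [h, Ne.symm h]
  · intro i hi
    rw [if_neg]
    rintro ⟨_, _, h⟩
    apply hi
    funext j
    rw [← h]; congr 1; omega

theorem gD_succ (a : ℕ → S) (N : ℕ) (g φ : List S → R) (s k : ℕ) (hs : s ≤ N) :
    gD a N g φ s (k + 1) = ∑ m : Fin (N + 1), if s < m then
      g (gseg a s (m - s + 1)) * gD a N g (fun x => φ (a s :: x)) m k else 0 := by
  classical
  unfold gD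
  rw [← (Fin.consEquiv (fun _ : Fin (k + 2) => Fin (N + 1))).sum_comp, Fintype.sum_prod_type]
  rw [Fintype.sum_eq_single (⟨s, by omega⟩ : Fin (N + 1))]
  · simp only [Finset.mul_sum]
    have : ∀ m : Fin (N + 1), ∀ f : (Fin (k + 1) → Fin (N + 1)) → R,
      (if s < (m : ℕ) then ∑ i, f i else 0) = ∑ i, if s < (m : ℕ) then f i else 0 := by
      intro m f; split_ifs <;> simp
    simp only [this]
    rw [Finset.sum_comm]
    apply Finset.sum_congr rfl
    intro t _
    rw [Fintype.sum_eq_single (t 0)]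
    · have hsm : StrictMono ((Fin.consEquiv fun _ : Fin (k + 2) => Fin (N + 1))
          ((⟨s, by omega⟩ : Fin (N + 1)), t)) ↔ s < (t 0 : ℕ) ∧ StrictMono t :=
        strictMono_cons_iff _ _
      simp only [hsm]
      simp only [Fin.consEquiv_apply, Fin.cons_zero, ← Fin.succ_last,
        Fin.cons_succ]
      by_cases h0 : s < (t 0 : ℕ)
      · simp only [h0, true_and, if_true]
        split_ifs
        · rw [Fin.prod_univ_succ, List.ofFn_succ]
          simp only [Fin.castSucc_zero, Fin.cons_zero, Fin.cons_succ, ← Fin.succ_castSucc]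
          ring
        · simp
      · simp [h0]
    · intro m hm
      have : ¬ ((t 0 : ℕ) = m) := fun h => hm (Fin.ext h.symm)
      simp [this]
  · intro m hm
    apply Finset.sum_eq_zero
    intro t _
    rw [if_neg]
    rintro ⟨_, h, _⟩
    apply hm
    exact Fin.ext (by simpa using h)

theorem gD_sum (a : ℕ → S) (N : ℕ) (g : List S → R) (M : ℕ) : ∀ (φ : List S → R) (s : ℕ),
    s ≤ N → N - s ≤ M →
    ∑ k ∈ Finset.range (M + 1), gD a N g φ s k = gT g φ (gseg a s (N - s + 1)) := by
  induction M with
  | zero =>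
    intro φ s hs h
    have : s = N := by omega
    subst this
    simp [gD_zero, gseg, gT_single]
  | succ M ih =>
    intro φ s hs h
    rw [Finset.sum_range_succ', gD_zero _ _ _ _ _ hs, gseg_succ, gT_cons, gprod_seg, add_comm]
    congr 1
    · have : gseg a (s + 1) (N - s) = [] ↔ s = N := by simp [gseg]; omega
      simp only [this]
    · simp only [gD_succ _ _ _ _ _ _ hs]
      rw [Finset.sum_comm]
      have e : ∀ m : Fin (N + 1), (∑ k ∈ Finset.range (M + 1), if s < (m : ℕ) then
          g (gseg a s (m - s + 1)) * gD a N g (fun x => φ (a s :: x)) m k else 0)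
          = (fun m : ℕ => if s < m then g (gseg a s (m - s + 1)) *
            gT g (fun x => φ (a s :: x)) (gseg a m (N - m + 1)) else 0) (m : ℕ) := by
        intro m
        by_cases hm : s < (m : ℕ)
        · simp only [hm, if_true]
          rw [← Finset.mul_sum, ih _ _ (by omega) (by omega)]
        · simp [hm]
      simp only [e]
      rw [Fin.sum_univ_eq_sum_range (fun m : ℕ => if s < m then g (gseg a s (m - s + 1)) *
            gT g (fun x => φ (a s :: x)) (gseg a m (N - m + 1)) else 0)]
      have : N + 1 = (s + 1) + (N - s) := by omega
      rw [this, Finset.sum_range_add, Finset.sum_eq_zero, zero_add]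
      · apply Finset.sum_congr rfl
        intro m hm
        have hm := Finset.mem_range.1 hm
        rw [if_pos (by omega), ← gseg_succ]
        congr 3 <;> omega
      · intro m hm
        have hm := Finset.mem_range.1 hm
        rw [if_neg (by omega)]

end GonAux

section GonBridge
variable {S : Type}

/-- List version of the symbols. -/
noncomputable def gLI (l : List S) : GonAlg S :=
  if h : l.length < 2 then 0 else Isym S (l.length - 1) (fun i => l.get (Fin.cast (by omega) i))

theorem gLI_eq (n : ℕ) (hn : 1 ≤ n) (a : Fin (n + 1) → S) (l : List S) (hl : l.length = n + 1)
    (h : ∀ i : ℕ, ∀ hi : i < n + 1, l[i] = a ⟨i, hi⟩) : gLI l = Isym S n a := by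
  obtain rfl : n = l.length - 1 := by omega
  rw [gLI, dif_neg (by omega)]
  congr 1
  funext i
  exact h i i.2

theorem gLI_short (l : List S) (h : l.length < 2) : gLI l = 0 := by simp [gLI, h]

theorem gLI_two (a b : S) : gLI [a, b] = 1 := by simp [gLI, Isym]

theorem gLI_gen (v : GonVars S) : gLI (List.ofFn v.2) = MvPolynomial.X v := by
  rw [gLI_eq (v.1 + 2) (by omega) v.2 _ (by simp) (by intro i hi; simp [List.getElem_ofFn, -List.ofFn_succ]), Isym, dif_pos (by omega)]
  rfl

theorem gLI_norm : gNorm (gLI : List S → GonAlg S) :=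
  ⟨gLI_short _ (by simp), fun _ => gLI_short _ (by simp), gLI_two⟩

/-- Extension of a finite sequence. -/
def gext {N : ℕ} (a : Fin (N + 1) → S) (i : ℕ) : S := if h : i < N + 1 then a ⟨i, h⟩ else a 0

theorem gext_coe {N : ℕ} (a : Fin (N + 1) → S) (i : Fin (N + 1)) : gext a i = a i := by
  rw [gext, dif_pos i.2]

theorem gbridge (α β : GonAlg S →ₐ[ℚ] GonAlg S) (v : GonVars S) :
    Algebra.TensorProduct.lift α β (fun _ _ => Commute.all _ _) (GonDeltaGen S v)
      = gT (fun l => β (gLI l)) (fun l => α (gLI l)) (List.ofFn v.2) := by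
  classical
  obtain ⟨n, a⟩ := v
  have hseg : List.ofFn a = gseg (gext (N := n + 2) a) 0 (n + 2 - 0 + 1) := by
    apply List.ext_getElem
    · simp [gseg]
    · intro i h1 h2
      have : i < n + 2 + 1 := by simpa using h1
      simp [gseg, gext, this, -List.ofFn_succ]
  rw [hseg, ← gD_sum _ (n + 2) _ (n + 2) _ 0 (by omega) (by omega), Finset.sum_range_succ',
    gD_zero _ _ _ _ _ (by omega), if_neg (by omega), add_zero, GonDeltaGen, map_sum]
  have hr : ∀ f : ℕ → GonAlg S,
      ∑ k ∈ Finset.range (n + 2), f (k + 1) = ∑ k ∈ Finset.Icc 1 (n + 2), f k := by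
    intro f
    rw [Finset.range_eq_Ico, Finset.sum_Ico_add' f 0 (n + 2) 1]
    rfl
  rw [hr (fun k => gD _ _ _ _ _ k)]
  apply Finset.sum_congr rfl
  intro k hk
  have hk1 : 1 ≤ k := (Finset.mem_Icc.1 hk).1
  letI : Fintype (Chains (n + 2) k) := Fintype.ofFinite _
  rw [finsum_eq_sum_of_fintype, map_sum, gD, ← Finset.sum_filter]
  have hmem : ∀ x : Fin (k + 1) → Fin (n + 2 + 1),
      x ∈ Finset.univ.filter (fun i : Fin (k + 1) → Fin (n + 2 + 1) =>
        StrictMono i ∧ (i 0 : ℕ) = 0 ∧ i (Fin.last k) = Fin.last (n + 2)) ↔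
      (StrictMono x ∧ x 0 = 0 ∧ x (Fin.last k) = Fin.last (n + 2)) := by
    intro x
    have h0 : x 0 = 0 ↔ (x 0 : ℕ) = 0 := Fin.ext_iff
    rw [Finset.mem_filter, h0]
    simp
  letI : Fintype {i : Fin (k + 1) → Fin (n + 2 + 1) // StrictMono i ∧ i 0 = 0 ∧
    i (Fin.last k) = Fin.last (n + 2)} := (inferInstance : Fintype (Chains (n + 2) k))
  rw [Finset.sum_subtype _ hmem]
  apply Finset.sum_congr rfl
  intro i _
  rw [Algebra.TensorProduct.lift_tmul, map_prod]
  congr 1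
  · rw [gLI_eq k hk1 (fun j => a (i.1 j)) _ (by simp)]
    intro t ht
    simp only [List.getElem_ofFn]
    exact gext_coe (N := n + 2) a _
  · apply Finset.prod_congr rfl
    intro j _
    have hlt : (i.1 j.castSucc : ℕ) < (i.1 j.succ : ℕ) := i.2.1 (Fin.castSucc_lt_succ)
    have hN : (i.1 j.succ : ℕ) < n + 2 + 1 := (i.1 j.succ).2
    congr 1
    symm
    apply gLI_eq _ (by omega)
    · intro t ht
      simp only [gseg, List.getElem_map, List.getElem_range', one_mul]
      rw [gext, dif_pos (by omega)]
    · simp [gseg]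

theorem ge_gen (v : GonVars S) : ge S (GonAlg S) (List.ofFn v.2) = 0 := by
  simp [ge]

end GonBridge

theorem goncharov_hopf (S : Type) :
    ∃ Antip : GonAlg S →ₗ[ℚ] GonAlg S,
      (LinearMap.mul' ℚ (GonAlg S)).comp
          ((TensorProduct.map Antip LinearMap.id).comp (GonDelta S).toLinearMap)
        = (Algebra.linearMap ℚ (GonAlg S)).comp (GonEps S).toLinearMap
      ∧ (LinearMap.mul' ℚ (GonAlg S)).comp
          ((TensorProduct.map LinearMap.id Antip).comp (GonDelta S).toLinearMap)
        = (Algebra.linearMap ℚ (GonAlg S)).comp (GonEps S).toLinearMap := by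
  obtain ⟨B, hB, h1, h2⟩ := exists_inv (gLI : List S → GonAlg S) gLI_norm
  let A : GonAlg S →ₐ[ℚ] GonAlg S := MvPolynomial.aeval (fun v => B (List.ofFn v.2))
  have hA : (fun l => A (gLI l)) = B := by
    funext l
    match l with
    | [] => rw [gLI_norm.1, map_zero, hB.1]
    | [a] => rw [gLI_norm.2.1, map_zero, hB.2.1]
    | [a, b] => rw [gLI_norm.2.2, map_one, hB.2.2]
    | a :: b :: c :: t =>
      have h := gLI_gen (⟨t.length, (a :: b :: c :: t).get⟩ : GonVars S)
      have h' : List.ofFn (a :: b :: c :: t).get = a :: b :: c :: t := List.ofFn_get _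
      have h3 := congrArg A h
      rw [MvPolynomial.aeval_X] at h3
      exact (congrArg (fun l => A (gLI l)) h').symm.trans (h3.trans (congrArg B h'))
  have hid : (fun l => AlgHom.id ℚ (GonAlg S) (gLI l)) = gLI := rfl
  have key : ∀ α β : GonAlg S →ₐ[ℚ] GonAlg S,
      gT (fun l => β (gLI l)) (fun l => α (gLI l)) = ge S (GonAlg S) →
      (LinearMap.mul' ℚ (GonAlg S)).comp
          ((TensorProduct.map α.toLinearMap β.toLinearMap).comp (GonDelta S).toLinearMap)
        = (Algebra.linearMap ℚ (GonAlg S)).comp (GonEps S).toLinearMap := by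
    intro α β h
    have e : (Algebra.TensorProduct.lift α β (fun _ _ => Commute.all _ _)).comp (GonDelta S)
        = (Algebra.ofId ℚ (GonAlg S)).comp (GonEps S) := by
      apply MvPolynomial.algHom_ext
      intro v
      rw [AlgHom.comp_apply, AlgHom.comp_apply, GonDelta, GonEps, MvPolynomial.aeval_X,
        MvPolynomial.aeval_X, gbridge, h, ge_gen, map_zero]
    have e' : (LinearMap.mul' ℚ (GonAlg S)).comp (TensorProduct.map α.toLinearMap β.toLinearMap)
        = (Algebra.TensorProduct.lift α β (fun _ _ => Commute.all _ _)).toLinearMap := by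
      apply TensorProduct.ext'
      intro x y
      simp
    rw [← LinearMap.comp_assoc, e']
    exact congrArg AlgHom.toLinearMap e
  refine ⟨A.toLinearMap, ?_, ?_⟩
  · exact key A (AlgHom.id ℚ _) (by rw [hA, hid]; exact h2)
  · exact key (AlgHom.id ℚ _) A (by rw [hA, hid]; exact h1)
end

section
/- For a decomposition finite category C, the deconcatenation coproduct Δ on B is coassociative, (Δ ⊗ id) ∘ Δ = (id ⊗ Δ) ∘ Δ, and ε is a two-sided counit, (ε ⊗ id) ∘ Δ = id_B = (id ⊗ ε) ∘ Δ; thus (B, Δ, ε) is a coassociative counital coalgebra over ℤ. -/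
open CategoryTheory
open scoped TensorProduct

universe v u

variable (C : Type u) [Category.{v} C]

/-- The type of all morphisms of `C`. -/
def Mor := Σ (X : C) (Y : C), X ⟶ Y

/-- The type of factorizations `φ = φ₀ ∘ φ₁` of a morphism `φ : X ⟶ Y` through some
object `Z`, i.e. triples `(Z, φ₁ : X ⟶ Z, φ₀ : Z ⟶ Y)` with `φ₁ ≫ φ₀ = φ`. -/
def Factorizations {X Y : C} (φ : X ⟶ Y) : Type max u v :=
  {p : Σ Z : C, (X ⟶ Z) × (Z ⟶ Y) // p.2.1 ≫ p.2.2 = φ}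

/-- A category is decomposition finite if every morphism has only finitely many
factorizations. -/
def DecompositionFinite : Prop :=
  ∀ (X Y : C) (φ : X ⟶ Y), Finite (Factorizations C φ)

/-- The free `ℤ`-module on the set of morphisms of `C`. -/
abbrev MorMod := Mor C →₀ ℤ

/-- The basis element corresponding to a morphism. -/
noncomputable def morGen {X Y : C} (φ : X ⟶ Y) : MorMod C :=
  Finsupp.single ⟨X, Y, φ⟩ 1

/-- The deconcatenation coproduct: `Δ(φ) = Σ_{φ = φ₀ ∘ φ₁} φ₀ ⊗ φ₁`. -/
noncomputable def coprod : MorMod C →ₗ[ℤ] MorMod C ⊗[ℤ] MorMod C :=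
  Finsupp.lift (MorMod C ⊗[ℤ] MorMod C) ℤ (Mor C) fun m =>
    ∑ᶠ p : Factorizations C m.2.2,
      morGen C p.1.2.2 ⊗ₜ[ℤ] morGen C p.1.2.1

/-- The counit: `ε(φ) = 1` if `φ` is an identity morphism and `0` otherwise. -/
noncomputable def counit : MorMod C →ₗ[ℤ] ℤ :=
  Finsupp.lift ℤ ℤ (Mor C) fun m =>
    letI := Classical.propDecidable (∃ Z : C, m = ⟨Z, Z, 𝟙 Z⟩)
    if ∃ Z : C, m = ⟨Z, Z, 𝟙 Z⟩ then 1 else 0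

lemma lift_single_one {R M : Type*} [CommRing R] [AddCommGroup M] [Module R M] {α : Type*}
    (f : α → M) (a : α) : Finsupp.lift M R α f (Finsupp.single a 1) = f a := by
  rw [Finsupp.lift_apply, Finsupp.sum_single_index] <;> simp

section generic
variable {R A : Type*} [CommRing R] [AddCommGroup A] [Module R A]
  (D : A →ₗ[R] A ⊗[R] A) (e : A →ₗ[R] R) {ι : Type*} [Fintype ι] (x : A) (f g : ι → A)

lemma gen_left {κ : ι → Type*} [∀ i, Fintype (κ i)] (f' g' : ∀ i, κ i → A)
    (hx : D x = ∑ i, f i ⊗ₜ[R] g i) (hf : ∀ i, D (f i) = ∑ j, f' i j ⊗ₜ[R] g' i j) :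
    (TensorProduct.assoc R A A A).toLinearMap.comp
        ((TensorProduct.map D LinearMap.id).comp D) x
      = ∑ p : Σ i, κ i, f' p.1 p.2 ⊗ₜ[R] (g' p.1 p.2 ⊗ₜ[R] g p.1) := by
  simp [hx, hf, TensorProduct.sum_tmul, Fintype.sum_sigma]

lemma gen_right {κ : ι → Type*} [∀ i, Fintype (κ i)] (f' g' : ∀ i, κ i → A)
    (hx : D x = ∑ i, f i ⊗ₜ[R] g i) (hg : ∀ i, D (g i) = ∑ j, f' i j ⊗ₜ[R] g' i j) :
    (TensorProduct.map LinearMap.id D).comp D x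
      = ∑ p : Σ i, κ i, f p.1 ⊗ₜ[R] (f' p.1 p.2 ⊗ₜ[R] g' p.1 p.2) := by
  simp [hx, hg, TensorProduct.tmul_sum, Fintype.sum_sigma]

lemma gen_lid (hx : D x = ∑ i, f i ⊗ₜ[R] g i) (i₀ : ι) (h1 : e (f i₀) = 1)
    (h0 : ∀ i, i ≠ i₀ → e (f i) = 0) (hg : g i₀ = x) :
    (TensorProduct.lid R A).toLinearMap.comp ((TensorProduct.map e LinearMap.id).comp D) x = x := by
  have : ∑ i, e (f i) • g i = x := by
    rw [Fintype.sum_eq_single i₀ (fun i hi => by rw [h0 i hi, zero_smul]), h1, one_smul, hg]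
  simpa [hx] using this

lemma gen_rid (hx : D x = ∑ i, f i ⊗ₜ[R] g i) (i₀ : ι) (h1 : e (g i₀) = 1)
    (h0 : ∀ i, i ≠ i₀ → e (g i) = 0) (hf : f i₀ = x) :
    (TensorProduct.rid R A).toLinearMap.comp ((TensorProduct.map LinearMap.id e).comp D) x = x := by
  have : ∑ i, e (g i) • f i = x := by
    rw [Fintype.sum_eq_single i₀ (fun i hi => by rw [h0 i hi, zero_smul]), h1, one_smul, hf]
  simpa [hx] using this

end generic

/-- Constructor for factorizations. -/
def factMk {X Y : C} (φ : X ⟶ Y) (Z : C) (a : X ⟶ Z) (b : Z ⟶ Y) (k : a ≫ b = φ) :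
    Factorizations C φ := ⟨⟨Z, a, b⟩, k⟩

lemma coprod_morGen {X Y : C} (φ : X ⟶ Y)
    [Fintype (Factorizations C φ)] :
    coprod C (morGen C φ) = ∑ p : Factorizations C φ,
      morGen C p.1.2.2 ⊗ₜ[ℤ] morGen C p.1.2.1 := by
  rw [← finsum_eq_sum_of_fintype]
  exact lift_single_one _ (⟨X, Y, φ⟩ : Mor C)

lemma counit_morGen_id (X : C) : counit C (morGen C (𝟙 X)) = 1 := by
  exact (lift_single_one _ (⟨X, X, 𝟙 X⟩ : Mor C)).trans (if_pos ⟨X, rfl⟩)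

lemma counit_morGen_ne {X Y : C} (φ : X ⟶ Y)
    (hφ : ¬ ∃ Z : C, (⟨X, Y, φ⟩ : Mor C) = ⟨Z, Z, 𝟙 Z⟩) : counit C (morGen C φ) = 0 := by
  exact (lift_single_one _ (⟨X, Y, φ⟩ : Mor C)).trans (if_neg hφ)

/-- Reassociation of threefold factorizations. -/
def factEquiv {X Y : C} (φ : X ⟶ Y) :
    (Σ p : Factorizations C φ, Factorizations C p.1.2.2) ≃
    (Σ p : Factorizations C φ, Factorizations C p.1.2.1) where
  toFun x := ⟨⟨⟨x.2.1.1, x.1.1.2.1 ≫ x.2.1.2.1, x.2.1.2.2⟩, by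
      have h1 := x.1.2
      have h2 := x.2.2
      simp only [Category.assoc]
      rw [h2, h1]⟩, ⟨⟨x.1.1.1, x.1.1.2.1, x.2.1.2.1⟩, rfl⟩⟩
  invFun x := ⟨⟨⟨x.2.1.1, x.2.1.2.1, x.2.1.2.2 ≫ x.1.1.2.2⟩, by
      have h1 := x.1.2
      have h2 := x.2.2
      simp only [← Category.assoc]
      rw [h2, h1]⟩, ⟨⟨x.1.1.1, x.2.1.2.2, x.1.1.2.2⟩, rfl⟩⟩
  left_inv := by
    rintro ⟨⟨⟨Z, a, b⟩, h⟩, ⟨⟨W, c, d⟩, k⟩⟩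
    dsimp only at h k c d
    subst k
    rfl
  right_inv := by
    rintro ⟨⟨⟨Z, a, b⟩, h⟩, ⟨⟨W, c, d⟩, k⟩⟩
    dsimp only at h k c d
    subst k
    rfl

lemma MorMod_ext {M : Type*} [AddCommMonoid M] [Module ℤ M] {f g : MorMod C →ₗ[ℤ] M}
    (H : ∀ (X Y : C) (φ : X ⟶ Y), f (morGen C φ) = g (morGen C φ)) : f = g := by
  apply Finsupp.lhom_ext'
  rintro ⟨X, Y, φ⟩
  apply LinearMap.ext_ring
  exact H X Y φ

theorem deconcatenation_coalgebra (h : DecompositionFinite C) :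
    ((TensorProduct.assoc ℤ (MorMod C) (MorMod C) (MorMod C)).toLinearMap.comp
        ((TensorProduct.map (coprod C) LinearMap.id).comp (coprod C))
      = (TensorProduct.map LinearMap.id (coprod C)).comp (coprod C))
    ∧ ((TensorProduct.lid ℤ (MorMod C)).toLinearMap.comp
        ((TensorProduct.map (counit C) LinearMap.id).comp (coprod C)) = LinearMap.id)
    ∧ ((TensorProduct.rid ℤ (MorMod C)).toLinearMap.comp
        ((TensorProduct.map LinearMap.id (counit C)).comp (coprod C)) = LinearMap.id) := by
  classical
  have (X Y : C) (φ : X ⟶ Y) : Fintype (Factorizations C φ) :=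
    @Fintype.ofFinite _ (h X Y φ)
  refine ⟨?_, ?_, ?_⟩
  · apply MorMod_ext
    intro X Y φ
    refine (gen_left (coprod C) (morGen C φ) _ _ _ _ (coprod_morGen C φ)
      (fun p => coprod_morGen C p.1.2.2)).trans (Eq.trans ?_
      (gen_right (coprod C) (morGen C φ) _ _ _ _ (coprod_morGen C φ)
      (fun p => coprod_morGen C p.1.2.1)).symm)
    exact Fintype.sum_equiv (factEquiv C φ) _ _ (fun _ => rfl)
  · apply MorMod_ext
    intro X Y φ
    refine gen_lid (coprod C) (counit C) (morGen C φ) _ _ (coprod_morGen C φ)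
      (factMk C φ Y φ (𝟙 Y) (Category.comp_id φ)) (counit_morGen_id C _) ?_ rfl
    rintro ⟨⟨Z, a, b⟩, k⟩ hne
    apply counit_morGen_ne
    rintro ⟨W, hW⟩
    apply hne
    dsimp only at k hW
    cases hW
    rw [Category.comp_id] at k
    subst k
    rfl
  · apply MorMod_ext
    intro X Y φ
    refine gen_rid (coprod C) (counit C) (morGen C φ) _ _ (coprod_morGen C φ)
      (factMk C φ X (𝟙 X) φ (Category.id_comp φ)) (counit_morGen_id C _) ?_ rfl
    rintro ⟨⟨Z, a, b⟩, k⟩ hne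
    apply counit_morGen_ne
    rintro ⟨W, hW⟩
    apply hne
    dsimp only at k hW
    cases hW
    rw [Category.id_comp] at k
    subst k
    rfl
end

section
/- Let F : C → D be a functor between decomposition finite categories such that F is injective on objects and every morphism of D has only finitely many preimages under F. Define the ℤ-linear map F* : B(D) → B(C) on a morphism φ of D by F*(φ) = Σ_{ψ ∈ Mor(C) : F(ψ) = φ} ψ. Then F* is a morphism of coalgebras for the deconcatenation coproducts: Δ_C ∘ F* = (F* ⊗ F*) ∘ Δ_D. If moreover F is bijective on objects, then F* also preserves the counits: ε_C ∘ F* = ε_D. -/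
open CategoryTheory
open scoped TensorProduct

universe v u v' u'

variable (C : Type u) [Category.{v} C]

variable (D : Type u') [Category.{v'} D]

/-- The action of a functor on the type of morphisms. -/
def Fmor (F : C ⥤ D) : Mor C → Mor D :=
  fun m => ⟨F.obj m.1, F.obj m.2.1, F.map m.2.2⟩

/-- The pullback `F* : B(D) → B(C)`, sending a morphism `φ` of `D` to the sum of its
preimages under `F`. -/
noncomputable def pull (F : C ⥤ D) : MorMod D →ₗ[ℤ] MorMod C :=
  Finsupp.lift (MorMod C) ℤ (Mor D) fun m =>
    ∑ᶠ m' : {m' : Mor C // Fmor C D F m' = m}, Finsupp.single m'.1 (1 : ℤ)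

/-- `m` is the composite of `a` followed by `b`. -/
def IsComp {C : Type u} [Category.{v} C] (a b m : Mor C) : Prop :=
  ∃ (X Z Y : C) (f : X ⟶ Z) (g : Z ⟶ Y), a = ⟨X, Z, f⟩ ∧ b = ⟨Z, Y, g⟩ ∧ m = ⟨X, Y, f ≫ g⟩

theorem IsComp.unique {C : Type u} [Category.{v} C] {a b m n : Mor C}
    (h : IsComp a b m) (h' : IsComp a b n) : m = n := by
  obtain ⟨X, Z, Y, f, g, rfl, rfl, rfl⟩ := h
  obtain ⟨X', Z', Y', f', g', h1, h2, rfl⟩ := h'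
  cases h1
  cases h2
  rfl

theorem IsComp.map {C : Type u} [Category.{v} C] {D : Type u'} [Category.{v'} D] (F : C ⥤ D)
    {a b m : Mor C} (h : IsComp a b m) : IsComp (Fmor C D F a) (Fmor C D F b) (Fmor C D F m) := by
  obtain ⟨X, Z, Y, f, g, rfl, rfl, rfl⟩ := h
  exact ⟨F.obj X, F.obj Z, F.obj Y, F.map f, F.map g, rfl, rfl, by simp [Fmor]; rfl⟩

theorem IsComp.lift {C : Type u} [Category.{v} C] {D : Type u'} [Category.{v'} D] (F : C ⥤ D)
    (hinj : Function.Injective F.obj) {a b : Mor C} {n : Mor D}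
    (h : IsComp (Fmor C D F a) (Fmor C D F b) n) : ∃ m, IsComp a b m ∧ Fmor C D F m = n := by
  have key : ∃ m, IsComp a b m := by
    obtain ⟨X, Z, Y, f, g, h1, h2, -⟩ := h
    obtain ⟨A, B, s⟩ := a
    obtain ⟨B', E, t⟩ := b
    have e1 : F.obj B = Z := congrArg (fun x : Mor D => x.2.1) h1
    have e2 : F.obj B' = Z := congrArg (fun x : Mor D => x.1) h2
    obtain rfl : B = B' := hinj (e1.trans e2.symm)
    exact ⟨_, A, B, E, s, t, rfl, rfl, rfl⟩
  obtain ⟨m, hm⟩ := key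
  exact ⟨m, hm, (hm.map F).unique h⟩

/-- The pair of morphisms underlying a factorization. -/
def facPair {C : Type u} [Category.{v} C] (m : Mor C) (p : Factorizations C m.2.2) :
    {ab : Mor C × Mor C // IsComp ab.1 ab.2 m} :=
  ⟨(⟨m.1, p.1.1, p.1.2.1⟩, ⟨p.1.1, m.2.1, p.1.2.2⟩),
    ⟨_, _, _, p.1.2.1, p.1.2.2, rfl, rfl, by
      obtain ⟨X, Y, f⟩ := m
      obtain ⟨p, hp⟩ := p
      dsimp only at hp ⊢
      rw [hp]⟩⟩

theorem facPair_bijective {C : Type u} [Category.{v} C] (m : Mor C) :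
    Function.Bijective (facPair m) := by
  constructor
  · rintro ⟨⟨Z, f, g⟩, h⟩ ⟨⟨Z', f', g'⟩, h'⟩ e
    have e1 := congrArg (fun x => x.1.1) e
    have e2 := congrArg (fun x => x.1.2) e
    dsimp only [facPair] at e1 e2
    cases e1
    cases e2
    rfl
  · rintro ⟨⟨a, b⟩, X, Z, Y, f, g, h1, h2, h3⟩
    dsimp only at h1 h2
    subst h1 h2 h3
    exact ⟨⟨⟨Z, f, g⟩, rfl⟩, rfl⟩

theorem finite_comp {C : Type u} [Category.{v} C] (hC : DecompositionFinite C) (m : Mor C) :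
    Finite {ab : Mor C × Mor C // IsComp ab.1 ab.2 m} :=
  have := hC _ _ m.2.2
  Finite.of_surjective _ (facPair_bijective m).2

theorem coprod_single {C : Type u} [Category.{v} C] (m : Mor C) :
    coprod C (Finsupp.single m 1) =
      ∑ᶠ p : {ab : Mor C × Mor C // IsComp ab.1 ab.2 m},
        (Finsupp.single p.1.2 1 : MorMod C) ⊗ₜ[ℤ] (Finsupp.single p.1.1 1 : MorMod C) := by
  simp only [coprod, Finsupp.lift_apply, zero_smul, Finsupp.sum_single_index, one_smul]
  exact finsum_eq_of_bijective _ (facPair_bijective m) (fun p => rfl)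

theorem pull_single {C : Type u} [Category.{v} C] {D : Type u'} [Category.{v'} D] (F : C ⥤ D)
    (m : Mor D) : pull C D F (Finsupp.single m 1) =
      ∑ᶠ m' : {m' : Mor C // Fmor C D F m' = m}, Finsupp.single m'.1 (1 : ℤ) := by
  simp only [pull, Finsupp.lift_apply, zero_smul, Finsupp.sum_single_index, one_smul]

open Classical in
theorem counit_single {C : Type u} [Category.{v} C] (m : Mor C) :
    counit C (Finsupp.single m 1) = if ∃ Z : C, m = ⟨Z, Z, 𝟙 Z⟩ then 1 else 0 := by
  simp only [counit, Finsupp.lift_apply, zero_smul, Finsupp.sum_single_index, one_smul]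

theorem pull_is_coalgebra_map (F : C ⥤ D)
    (hC : DecompositionFinite C) (hD : DecompositionFinite D)
    (hinj : Function.Injective F.obj)
    (hfib : ∀ m : Mor D, Finite {m' : Mor C // Fmor C D F m' = m}) :
    ((coprod C).comp (pull C D F)
        = (TensorProduct.map (pull C D F) (pull C D F)).comp (coprod D))
    ∧ (Function.Bijective F.obj →
        (counit C).comp (pull C D F) = counit D) := by
  classical
  have : ∀ m : Mor D, Fintype {m' : Mor C // Fmor C D F m' = m} :=
    fun m => Fintype.ofFinite _
  constructor
  · haveI : ∀ m : Mor C, Fintype {ab : Mor C × Mor C // IsComp ab.1 ab.2 m} :=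
      fun m => haveI := finite_comp hC m; Fintype.ofFinite _
    have : ∀ m : Mor D, Fintype {ab : Mor D × Mor D // IsComp ab.1 ab.2 m} :=
      fun m => haveI := finite_comp hD m; Fintype.ofFinite _
    refine Finsupp.lhom_ext' fun m => LinearMap.ext_ring ?_
    change coprod C (pull C D F (Finsupp.single m 1)) =
      TensorProduct.map (pull C D F) (pull C D F) (coprod D (Finsupp.single m 1))
    rw [pull_single, coprod_single, finsum_eq_sum_of_fintype, finsum_eq_sum_of_fintype,
      map_sum, map_sum]
    simp only [TensorProduct.map_tmul, coprod_single, pull_single, finsum_eq_sum_of_fintype,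
      TensorProduct.sum_tmul, TensorProduct.tmul_sum]
    simp only [← Fintype.sum_prod_type']
    rw [← Fintype.sum_sigma', ← Fintype.sum_sigma']
    let S := {ab : Mor C × Mor C // IsComp (Fmor C D F ab.1) (Fmor C D F ab.2) m}
    let L : (Σ m' : {m' : Mor C // Fmor C D F m' = m},
        {ab : Mor C × Mor C // IsComp ab.1 ab.2 m'.1}) → S :=
      fun x => ⟨x.2.1, by have := x.2.2.map F; rwa [x.1.2] at this⟩
    let R : (Σ p : {ab : Mor D × Mor D // IsComp ab.1 ab.2 m},
        {m' : Mor C // Fmor C D F m' = p.1.1} × {m' : Mor C // Fmor C D F m' = p.1.2}) → S :=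
      fun x => ⟨(x.2.1.1, x.2.2.1), by
        dsimp only
        rw [x.2.1.2, x.2.2.2]
        exact x.1.2⟩
    have hL : Function.Bijective L := by
      constructor
      · rintro ⟨⟨n, hn⟩, ⟨ab, h⟩⟩ ⟨⟨n', hn'⟩, ⟨ab', h'⟩⟩ e
        obtain rfl : ab = ab' := congrArg Subtype.val e
        obtain rfl := h.unique h'
        rfl
      · rintro ⟨ab, h⟩
        obtain ⟨n, h1, h2⟩ := IsComp.lift F hinj h
        exact ⟨⟨⟨n, h2⟩, ⟨ab, h1⟩⟩, rfl⟩
    have hR : Function.Bijective R := by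
      constructor
      · rintro ⟨⟨⟨p, q⟩, hp⟩, ⟨⟨a, ha⟩, ⟨b, hb⟩⟩⟩ ⟨⟨⟨p', q'⟩, hp'⟩, ⟨⟨a', ha'⟩, ⟨b', hb'⟩⟩⟩ e
        have e1 : (a, b) = (a', b') := congrArg Subtype.val e
        cases e1
        dsimp only at ha hb ha' hb'
        subst ha hb ha' hb'
        rfl
      · rintro ⟨⟨a, b⟩, h⟩
        exact ⟨⟨⟨(_, _), h⟩, ⟨⟨a, rfl⟩, ⟨b, rfl⟩⟩⟩, rfl⟩
    have : Finite S := Finite.of_surjective _ hL.2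
    have : Fintype S := Fintype.ofFinite _
    let G : S → MorMod C ⊗[ℤ] MorMod C := fun s =>
      (Finsupp.single s.1.2 1 : MorMod C) ⊗ₜ[ℤ] (Finsupp.single s.1.1 1 : MorMod C)
    trans ∑ s, G s
    · exact Fintype.sum_bijective L hL _ _ fun _ => rfl
    · symm
      exact Fintype.sum_bijective R hR _ _ fun _ => rfl
  · intro hb
    refine Finsupp.lhom_ext' fun m => LinearMap.ext_ring ?_
    simp only [LinearMap.comp_apply, Finsupp.lsingle_apply]
    rw [pull_single, finsum_eq_sum_of_fintype, map_sum]
    simp only [counit_single]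
    split_ifs with h
    · obtain ⟨Z, hZ⟩ := h
      obtain ⟨W, rfl⟩ := hb.2 Z
      rw [Fintype.sum_eq_single
        (⟨⟨W, W, 𝟙 W⟩, by rw [hZ]; simp [Fmor]; rfl⟩ : {m' : Mor C // Fmor C D F m' = m})]
      · exact if_pos ⟨W, rfl⟩
      · rintro ⟨n, hn⟩ hne
        refine if_neg ?_
        rintro ⟨V, hV⟩
        dsimp only at hV
        subst hV
        obtain rfl : V = W := hinj (congrArg (fun x : Mor D => x.1) (hn.trans hZ))
        exact hne rfl
    · refine Finset.sum_eq_zero ?_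
      rintro ⟨n, hn⟩ -
      refine if_neg ?_
      rintro ⟨V, hV⟩
      dsimp only at hV
      subst hV
      exact h ⟨F.obj V, by rw [← hn]; simp [Fmor]; rfl⟩
end
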